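/- arXiv:2308.10238 — 2 statements merged into one kernel-verified Lean document; each statement's English description precedes it below -/
import Mathlib

section
/- Let A be a finite subset of {0,1}^d with |A| ≥ 2, let μ ∈ ℝ^d, and let π* ∈ A satisfy μᵀ(π* − π) > 0 for every π ∈ A \ {π*}. Assume for every s ∈ {1,…,d} there exists π ∈ A with π_s ≠ π*_s. With Δ_s = min over π ∈ A with π_s ≠ π*_s of μᵀ(π* − π), U_s = max over π' ∈ A and π ∈ A with π_s ≠ π*_s of (Σ_{e=1}^d |π_e − π'_e|²)/|π*_s − π_s|², and width = max_{π, π' ∈ A} Σ_{e=1}^d |π_e − π'_e|, one has H^N := Σ_{s=1}^d U_s/Δ_s² ≤ width · Σ_{s=1}^d 1/Δ_s². -/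
/-- The ordinary gap `Δ_s = min_{π ∈ A, π s ≠ π* s} μᵀ(π* - π)`. -/
noncomputable def gapD (d : ℕ) (A : Finset (Fin d → ℝ)) (μ πstar : Fin d → ℝ)
    (s : Fin d) : ℝ :=
  sInf {x : ℝ | ∃ π ∈ A, π s ≠ πstar s ∧ x = ∑ e, μ e * (πstar e - π e)}

/-- `U_s`: maximum over `π' ∈ A` and `π ∈ A` with `π s ≠ π* s` of
`(∑ e, |π e - π' e|²) / |π* s - π s|²`. -/
noncomputable def Uconst (d : ℕ) (A : Finset (Fin d → ℝ)) (πstar : Fin d → ℝ)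
    (s : Fin d) : ℝ :=
  sSup {x : ℝ | ∃ π' ∈ A, ∃ π ∈ A, π s ≠ πstar s ∧
    x = (∑ e, |π e - π' e| ^ 2) / |πstar s - π s| ^ 2}

/-- The width of the action set: `max_{π, π' ∈ A} ∑ e, |π e - π' e|`. -/
noncomputable def width (d : ℕ) (A : Finset (Fin d → ℝ)) : ℝ :=
  sSup {x : ℝ | ∃ π ∈ A, ∃ π' ∈ A, x = ∑ e, |π e - π' e|}

/-- The pairwise `ℓ¹` distances in a finite action set are bounded above by its width. -/
theorem sum_abs_sub_le_width (d : ℕ) (A : Finset (Fin d → ℝ)) {p q : Fin d → ℝ}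
    (hp : p ∈ A) (hq : q ∈ A) : ∑ e, |p e - q e| ≤ width d A := by
  refine le_csSup (Set.Finite.bddAbove ?_) ⟨p, hp, q, hq, rfl⟩
  refine ((A ×ˢ A).finite_toSet.image fun r => ∑ e, |r.1 e - r.2 e|).subset ?_
  rintro x ⟨a, ha, b, hb, rfl⟩
  exact ⟨(a, b), by simp [ha, hb], rfl⟩

/-- For binary actions, the constant `U_s` is at most the width. -/
theorem Uconst_le_width (d : ℕ) (A : Finset (Fin d → ℝ))
    (hbin : ∀ p ∈ A, ∀ s, p s = 0 ∨ p s = 1) (pstar : Fin d → ℝ) (hpstar : pstar ∈ A)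
    (s : Fin d) (hdiff : ∃ p ∈ A, p s ≠ pstar s) : Uconst d A pstar s ≤ width d A := by
  obtain ⟨p₀, hp₀, hne₀⟩ := hdiff
  refine csSup_le ⟨_, pstar, hpstar, p₀, hp₀, hne₀, rfl⟩ ?_
  rintro x ⟨q, hq, p, hp, hne, rfl⟩
  have hden : |pstar s - p s| ^ 2 = 1 := by
    rcases hbin p hp s with h | h <;> rcases hbin pstar hpstar s with h' | h' <;> simp_all
  have hnum : ∀ e, |p e - q e| ^ 2 = |p e - q e| := fun e => by
    rcases hbin p hp e with h | h <;> rcases hbin q hq e with h' | h' <;> simp [h, h']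
  simp only [hden, hnum, div_one]
  exact sum_abs_sub_le_width d A hp hq

/-- First inequality of Proposition 3 of the paper: in the ordinary CPE-MAB
(binary actions), `H^N = ∑ s, U_s / Δ_s² ≤ width · ∑ s, 1 / Δ_s²`. -/
theorem stmt4 (d : ℕ) (A : Finset (Fin d → ℝ))
    (hbin : ∀ π ∈ A, ∀ s, π s = 0 ∨ π s = 1) (hcard : 2 ≤ A.card)
    (μ πstar : Fin d → ℝ) (hπstar : πstar ∈ A)
    (hopt : ∀ π ∈ A, π ≠ πstar → 0 < ∑ e, μ e * (πstar e - π e))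
    (hdiff : ∀ s : Fin d, ∃ π ∈ A, π s ≠ πstar s) :
    ∑ s, Uconst d A πstar s / (gapD d A μ πstar s) ^ 2
      ≤ width d A * ∑ s, 1 / (gapD d A μ πstar s) ^ 2 := by
  rw [Finset.mul_sum]
  refine Finset.sum_le_sum fun s _ => ?_
  rw [mul_one_div]
  exact div_le_div_of_nonneg_right (Uconst_le_width d A hbin πstar hπstar s (hdiff s))
    (sq_nonneg _)
end

section
/- Let A be a finite subset of {0,1}^d with |A| ≥ 2, let μ ∈ ℝ^d, and let π* ∈ A satisfy μᵀ(π* − π) > 0 for every π ∈ A \ {π*}. Assume for every s ∈ {1,…,d} there exists π ∈ A with π_s ≠ π*_s. With Δ_s = min over π ∈ A with π_s ≠ π*_s of μᵀ(π* − π), V_s = max over π' ∈ A and π ∈ A with π_s ≠ π*_s of |π_s − π'_s| · (Σ_{e=1}^d |π_e − π'_e|)/|π*_s − π_s|², and width = max_{π, π' ∈ A} Σ_{e=1}^d |π_e − π'_e|, one has H^R := Σ_{s=1}^d V_s/Δ_s² ≤ width · Σ_{s=1}^d 1/Δ_s². -/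
/-- `V_s`: maximum over `π' ∈ A` and `π ∈ A` with `π s ≠ π* s` of
`|π s - π' s| · (∑ e, |π e - π' e|) / |π* s - π s|²`. -/
noncomputable def Vconst (d : ℕ) (A : Finset (Fin d → ℝ)) (πstar : Fin d → ℝ)
    (s : Fin d) : ℝ :=
  sSup {x : ℝ | ∃ π' ∈ A, ∃ π ∈ A, π s ≠ πstar s ∧
    x = |π s - π' s| * (∑ e, |π e - π' e|) / |πstar s - π s| ^ 2}

/-- The pairwise `ℓ¹` distances within a finite action set are bounded above. -/
theorem bddAbove_l1_dist (d : ℕ) (A : Finset (Fin d → ℝ)) :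
    BddAbove {x : ℝ | ∃ π ∈ A, ∃ π' ∈ A, x = ∑ e, |π e - π' e|} := by
  refine ((A ×ˢ A).finite_toSet.image
    fun p : (Fin d → ℝ) × (Fin d → ℝ) => ∑ e, |p.1 e - p.2 e|).bddAbove.mono ?_
  rintro x ⟨π, hπ, π', hπ', rfl⟩
  exact ⟨(π, π'), by simp [hπ, hπ'], rfl⟩

/-- For binary actions, `V_s` is at most the width. -/
theorem Vconst_le_width (d : ℕ) (A : Finset (Fin d → ℝ))
    (hbin : ∀ π ∈ A, ∀ s, π s = 0 ∨ π s = 1) (πstar : Fin d → ℝ) (hπstar : πstar ∈ A)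
    (s : Fin d) (hs : ∃ π ∈ A, π s ≠ πstar s) :
    Vconst d A πstar s ≤ width d A := by
  obtain ⟨π₀, hπ₀, hne₀⟩ := hs
  refine csSup_le ⟨_, πstar, hπstar, π₀, hπ₀, hne₀, rfl⟩ ?_
  rintro x ⟨π', hπ', π, hπ, hne, rfl⟩
  have hsq : |πstar s - π s| ^ 2 = 1 := by
    rcases hbin π hπ s with h | h <;> rcases hbin πstar hπstar s with h' | h' <;> simp_all
  have hle : |π s - π' s| ≤ 1 := by
    rcases hbin π hπ s with h | h <;> rcases hbin π' hπ' s with h' | h' <;> simp [h, h']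
  rw [hsq, div_one]
  exact (mul_le_of_le_one_left (Finset.sum_nonneg fun _ _ => abs_nonneg _) hle).trans
    (le_csSup (bddAbove_l1_dist d A) ⟨π, hπ, π', hπ', rfl⟩)

/-- Second inequality of Proposition 3 of the paper: in the ordinary CPE-MAB
(binary actions), `H^R = ∑ s, V_s / Δ_s² ≤ width · ∑ s, 1 / Δ_s²`. -/
theorem stmt5 (d : ℕ) (A : Finset (Fin d → ℝ))
    (hbin : ∀ π ∈ A, ∀ s, π s = 0 ∨ π s = 1) (hcard : 2 ≤ A.card)
    (μ πstar : Fin d → ℝ) (hπstar : πstar ∈ A)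
    (hopt : ∀ π ∈ A, π ≠ πstar → 0 < ∑ e, μ e * (πstar e - π e))
    (hdiff : ∀ s : Fin d, ∃ π ∈ A, π s ≠ πstar s) :
    ∑ s, Vconst d A πstar s / (gapD d A μ πstar s) ^ 2
      ≤ width d A * ∑ s, 1 / (gapD d A μ πstar s) ^ 2 := by
  rw [Finset.mul_sum]
  refine Finset.sum_le_sum fun s _ => ?_
  rw [mul_one_div]
  exact div_le_div_of_nonneg_right (Vconst_le_width d A hbin πstar hπstar s (hdiff s))
    (sq_nonneg _)
end
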